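/- Let p be a real polynomial of degree n ≥ 1 with positive leading coefficient, let s_0, s_1, s_2, … be the Laurent coefficients at infinity of R(z) = (−1)^n p(−z)/p(z), and let D_j(R) = det[(s_{i+k})_{i,k=0}^{j−1}]. Then p is Hurwitz stable if and only if (−1)^{j(j+1)/2} D_j(R) > 0 for every j = 1, 2, …, n. -/

import Mathlib

open Polynomial

/-- A real polynomial is *Hurwitz stable* if all of its complex roots have
negative real part. -/
def HurwitzStable (p : Polynomial ℝ) : Prop :=
  ∀ z : ℂ, Polynomial.aeval z p = 0 → z.re < 0

open scoped ComplexConjugate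

theorem Complex.mul_normSq_add_le {x a b d : ℝ} (hx : 0 < x) (ha : 0 ≤ a) (hb : 0 < b)
    (hd : 0 ≤ d) {u v : ℂ} (h : x * Complex.normSq u ≤ a * d) :
    b * (x * Complex.normSq (u + v)) ≤ (a + b) * (b * d + x * Complex.normSq v) := by
  rcases ha.eq_or_lt with rfl | ha
  · have hu : u = 0 := by
      rw [← Complex.normSq_eq_zero]
      nlinarith [Complex.normSq_nonneg u]
    subst hu
    have := mul_nonneg hb.le (mul_nonneg hb.le hd)
    simp only [zero_add]
    linarith
  · obtain ⟨u₁, u₂⟩ := u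
    obtain ⟨v₁, v₂⟩ := v
    simp only [Complex.normSq_apply, Complex.add_re, Complex.add_im] at *
    refine le_of_mul_le_mul_left ?_ ha
    have h₁ : 0 ≤ x * ((b * u₁ - a * v₁) ^ 2 + (b * u₂ - a * v₂) ^ 2) := by positivity
    have h₂ := mul_le_mul_of_nonneg_left h (by positivity : 0 ≤ (a + b) * b)
    linarith

/-- Comparison of `∏ (z - r)` with `∏ (z + conj r)`, for `z` in the right half-plane and all `r`
in the left half-plane. -/
theorem Multiset.normSq_prod_sub_le {z : ℂ} (hz : 0 < z.re) (m : Multiset ℂ)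
    (hm : ∀ r ∈ m, r.re < 0) :
    0 ≤ -m.sum.re ∧
    Complex.normSq (m.map fun r => z + conj r).prod ≤
      Complex.normSq (m.map fun r => z - r).prod ∧
    z.re * Complex.normSq ((m.map fun r => z - r).prod - (m.map fun r => z + conj r).prod) ≤
      -m.sum.re * (Complex.normSq (m.map fun r => z - r).prod -
        Complex.normSq (m.map fun r => z + conj r).prod) := by
  induction m using Multiset.induction_on with
  | empty => simp
  | cons r m ih =>
    have hr : 0 < -r.re := neg_pos.2 (hm r (Multiset.mem_cons_self r m))
    obtain ⟨hs, hle, hmain⟩ := ih fun q hq => hm q (Multiset.mem_cons_of_mem hq)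
    simp only [Multiset.map_cons, Multiset.prod_cons, Multiset.sum_cons, Complex.add_re]
    generalize (m.map fun r => z - r).prod = A at *
    generalize (m.map fun r => z + conj r).prod = B at *
    have hzr : Complex.normSq (z - r) = Complex.normSq (z + conj r) + 4 * z.re * -r.re := by
      simp only [Complex.normSq_apply, Complex.sub_re, Complex.sub_im, Complex.add_re,
        Complex.add_im, Complex.conj_re, Complex.conj_im]
      ring
    have hA := Complex.normSq_nonneg A
    have hZ := Complex.normSq_nonneg (z + conj r)
    have hD : 0 ≤ Complex.normSq A - Complex.normSq B := sub_nonneg.2 hle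
    have hZD := mul_nonneg hZ hD
    have hxA : 0 ≤ z.re * -r.re * Complex.normSq A := by positivity
    refine ⟨by linarith, ?_, ?_⟩
    · rw [Complex.normSq_mul, Complex.normSq_mul, hzr]
      linarith
    · have hsplit : (z - r) * A - (z + conj r) * B =
          (z + conj r) * (A - B) + ((2 * -r.re : ℝ) : ℂ) * A := by
        apply Complex.ext <;> simp <;> ring
      have := Complex.mul_normSq_add_le (u := (z + conj r) * (A - B))
        (v := ((2 * -r.re : ℝ) : ℂ) * A) hz hs hr hZD (by
          rw [Complex.normSq_mul]
          linarith [mul_le_mul_of_nonneg_left hmain hZ])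
      refine le_of_mul_le_mul_left ?_ hr
      rw [hsplit]
      refine this.trans (le_of_eq ?_)
      rw [Complex.normSq_mul, Complex.normSq_mul, Complex.normSq_mul, Complex.normSq_ofReal, hzr]
      ring

namespace Polynomial

variable {p : ℝ[X]} {z : ℂ}

theorem aeval_eq_leadingCoeff_mul_prod (p : ℝ[X]) (z : ℂ) :
    aeval z p = (p.leadingCoeff : ℂ) * ((p.aroots ℂ).map fun r => z - r).prod :=
  (IsAlgClosed.splits _).aeval_eq_prod_aroots z

theorem aeval_neg_eq_leadingCoeff_mul_prod (p : ℝ[X]) (z : ℂ) :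
    (-1) ^ p.natDegree * aeval (-z) p =
      (p.leadingCoeff : ℂ) * ((p.aroots ℂ).map fun r => z + conj r).prod := by
  have h : aeval (-z) p = conj (aeval (-conj z) p) := by
    rw [← aeval_conj]; simp
  have hc : (p.aroots ℂ).card = p.natDegree := IsAlgClosed.card_aroots_eq_natDegree
  rw [h, aeval_eq_leadingCoeff_mul_prod, map_mul, Complex.conj_ofReal, map_multiset_prod,
    Multiset.map_map, ← hc]
  have h₂ : (p.aroots ℂ).map (conj ∘ fun r => -conj z - r) =
      ((p.aroots ℂ).map fun r => z + conj r).map Neg.neg := by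
    rw [Multiset.map_map]
    exact Multiset.map_congr rfl fun r _ => by simp; ring
  have h₃ : ((-1 : ℂ) ^ (p.aroots ℂ).card) ^ 2 = 1 := by
    rw [← pow_mul, mul_comm, pow_mul]; simp
  rw [h₂, Multiset.prod_map_neg, Multiset.card_map]
  linear_combination
    (p.leadingCoeff : ℂ) * ((p.aroots ℂ).map fun r => z + conj r).prod * h₃

theorem nextCoeff_eq_neg_leadingCoeff_mul_sum_aroots_re (p : ℝ[X]) :
    p.nextCoeff = p.leadingCoeff * -(p.aroots ℂ).sum.re := by
  have := (IsAlgClosed.splits (p.map (algebraMap ℝ ℂ))).nextCoeff_eq_neg_sum_roots_mul_leadingCoeff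
  rw [nextCoeff_map (algebraMap ℝ ℂ).injective, leadingCoeff_map] at this
  have := congrArg Complex.re this
  simpa using this

end Polynomial

namespace HurwitzStable

variable {p : ℝ[X]}

theorem re_neg_of_mem_aroots (hp : HurwitzStable p) {r : ℂ} (hr : r ∈ p.aroots ℂ) : r.re < 0 :=
  hp r (mem_aroots.1 hr).2

theorem nextCoeff_pos (hp : HurwitzStable p) (hlead : 0 < p.leadingCoeff)
    (hdeg : 0 < p.natDegree) : 0 < p.nextCoeff := by
  rw [nextCoeff_eq_neg_leadingCoeff_mul_sum_aroots_re]
  refine mul_pos hlead ?_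
  have hc : (p.aroots ℂ).card = p.natDegree := IsAlgClosed.card_aroots_eq_natDegree
  obtain ⟨r, hr⟩ := Multiset.card_pos_iff_exists_mem.1 (hc ▸ hdeg)
  obtain ⟨m, hm⟩ := Multiset.exists_cons_of_mem hr
  have hroot : ∀ q ∈ p.aroots ℂ, q.re < 0 := fun q hq => hp.re_neg_of_mem_aroots hq
  have hm' := (Multiset.normSq_prod_sub_le (z := 1) (by simp) m fun q hq =>
    hroot q (hm ▸ Multiset.mem_cons_of_mem hq)).1
  rw [hm, Multiset.sum_cons, Complex.add_re]
  linarith [hroot r hr]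

theorem normSq_aeval_neg_le (hp : HurwitzStable p) {z : ℂ} (hz : 0 < z.re) :
    Complex.normSq ((-1) ^ p.natDegree * aeval (-z) p) ≤ Complex.normSq (aeval z p) := by
  rw [aeval_neg_eq_leadingCoeff_mul_prod, aeval_eq_leadingCoeff_mul_prod, Complex.normSq_mul,
    Complex.normSq_mul]
  exact mul_le_mul_of_nonneg_left
    (Multiset.normSq_prod_sub_le hz _ fun _ => hp.re_neg_of_mem_aroots).2.1
    (Complex.normSq_nonneg _)

theorem normSq_aeval_sub_aeval_neg_le (hp : HurwitzStable p) (hlead : 0 < p.leadingCoeff)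
    {z : ℂ} (hz : 0 < z.re) :
    p.leadingCoeff * z.re *
        Complex.normSq (aeval z p - (-1) ^ p.natDegree * aeval (-z) p) ≤
      p.nextCoeff * (Complex.normSq (aeval z p) -
        Complex.normSq ((-1) ^ p.natDegree * aeval (-z) p)) := by
  rw [aeval_neg_eq_leadingCoeff_mul_prod, aeval_eq_leadingCoeff_mul_prod, ← mul_sub,
    Complex.normSq_mul, Complex.normSq_mul, Complex.normSq_mul, Complex.normSq_ofReal,
    nextCoeff_eq_neg_leadingCoeff_mul_sum_aroots_re]
  have h := (Multiset.normSq_prod_sub_le hz _ fun _ => hp.re_neg_of_mem_aroots).2.2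
  have := mul_le_mul_of_nonneg_left h (by positivity :
    0 ≤ p.leadingCoeff * (p.leadingCoeff * p.leadingCoeff))
  linarith

end HurwitzStable

namespace Polynomial

/-- One step of the Routh reduction: with `c` the quotient of the two leading coefficients of `p`
and `O(z) = (p(z) - (-1)^n p(-z)) / 2`, this is `p(z) - c z O(z)`. -/
noncomputable def routhStep (p : ℝ[X]) : ℝ[X] :=
  p - C (p.leadingCoeff / p.nextCoeff / 2) * X * (p - C ((-1) ^ p.natDegree) * p.comp (-X))

variable {p : ℝ[X]} {n : ℕ}

theorem coeff_routhStep_succ (p : ℝ[X]) (k : ℕ) :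
    p.routhStep.coeff (k + 1) = p.coeff (k + 1) -
      p.leadingCoeff / p.nextCoeff / 2 * (p.coeff k - (-1) ^ (p.natDegree + k) * p.coeff k) := by
  have h : (-X : ℝ[X]) = C (-1) * X := by simp
  rw [routhStep, coeff_sub, mul_assoc, coeff_C_mul, coeff_X_mul, coeff_sub, coeff_C_mul, h,
    comp_C_mul_X_coeff]
  ring

theorem coeff_routhStep_zero (p : ℝ[X]) : p.routhStep.coeff 0 = p.coeff 0 := by
  simp [routhStep, mul_assoc]

theorem nextCoeff_of_natDegree_succ (hdeg : p.natDegree = n + 1) : p.nextCoeff = p.coeff n := by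
  simp [nextCoeff, hdeg]

theorem coeff_routhStep_natDegree_pred (hdeg : p.natDegree = n + 1) :
    p.routhStep.coeff n = p.coeff n := by
  cases n with
  | zero => exact coeff_routhStep_zero p
  | succ n =>
    rw [coeff_routhStep_succ, hdeg, show n + 1 + 1 + n = 2 * (n + 1) by ring, pow_mul]
    simp

theorem natDegree_routhStep (hdeg : p.natDegree = n + 1) (hnext : p.nextCoeff ≠ 0) :
    p.routhStep.natDegree = n := by
  refine natDegree_eq_of_le_of_coeff_ne_zero (natDegree_le_iff_coeff_eq_zero.2 fun k hk => ?_) ?_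
  · obtain ⟨k, rfl⟩ : ∃ j, k = j + 1 := ⟨k - 1, by omega⟩
    rw [coeff_routhStep_succ]
    rcases (Nat.lt_succ_iff.1 hk).eq_or_lt with rfl | hk
    · rw [nextCoeff_of_natDegree_succ hdeg] at *
      rw [hdeg, leadingCoeff, hdeg, show n + 1 + n = 2 * n + 1 by ring, pow_succ, pow_mul]
      field_simp
      ring
    · rw [coeff_eq_zero_of_natDegree_lt (show p.natDegree < k + 1 by omega)]
      rcases (Nat.succ_le_iff.2 hk).eq_or_lt with rfl | hk
      · rw [hdeg, pow_add, ← mul_pow]; simp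
      · rw [coeff_eq_zero_of_natDegree_lt (show p.natDegree < k by omega)]; simp
  · rwa [coeff_routhStep_natDegree_pred hdeg, ← nextCoeff_of_natDegree_succ hdeg]

theorem leadingCoeff_routhStep (hdeg : p.natDegree = n + 1) (hnext : p.nextCoeff ≠ 0) :
    p.routhStep.leadingCoeff = p.nextCoeff := by
  rw [leadingCoeff, natDegree_routhStep hdeg hnext, coeff_routhStep_natDegree_pred hdeg,
    nextCoeff_of_natDegree_succ hdeg]

theorem aeval_routhStep (p : ℝ[X]) (z : ℂ) :
    aeval z p.routhStep = aeval z p - (p.leadingCoeff / p.nextCoeff : ℝ) * z *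
      ((aeval z p - (-1) ^ p.natDegree * aeval (-z) p) / 2) := by
  simp only [routhStep, map_sub, map_mul, aeval_C, aeval_X, aeval_comp, map_neg, map_pow]
  simp
  ring

theorem aeval_neg_routhStep (hdeg : p.natDegree = n + 1) (z : ℂ) :
    (-1) ^ n * aeval (-z) p.routhStep =
      -((-1) ^ p.natDegree * aeval (-z) p) + (p.leadingCoeff / p.nextCoeff : ℝ) * z *
        ((aeval z p - (-1) ^ p.natDegree * aeval (-z) p) / 2) := by
  have h : ((-1 : ℂ) ^ n) ^ 2 = 1 := by rw [← pow_mul, mul_comm, pow_mul]; simp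
  rw [aeval_routhStep, hdeg, neg_neg, pow_succ]
  linear_combination (aeval z p * z * (p.leadingCoeff / p.nextCoeff : ℝ) / 2) * h

/-- A step of Routh's algorithm preserves stability. -/
theorem hurwitzStable_routhStep_iff (hdeg : p.natDegree = n + 1) (hlead : 0 < p.leadingCoeff)
    (hnext : 0 < p.nextCoeff) : HurwitzStable p.routhStep ↔ HurwitzStable p := by
  have hq : p.routhStep.natDegree = n := natDegree_routhStep hdeg hnext.ne'
  have hc : 0 < p.leadingCoeff / p.nextCoeff := div_pos hlead hnext
  have haxis : ∀ (r : ℝ[X]) (z : ℂ), z.re = 0 → aeval z r = 0 → aeval (-z) r = 0 := by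
    intro r z hz h
    have : -z = conj z := Complex.ext (by simp [hz]) (by simp)
    rw [this, aeval_conj, h, map_zero]
  constructor
  · intro hs z hpz
    by_contra! hz
    have h₁ := aeval_routhStep p z
    have h₂ := aeval_neg_routhStep hdeg z
    have hqz : aeval z p.routhStep = 0 := by
      rcases hz.eq_or_lt with hz | hz
      · simpa [hpz, haxis p z hz.symm hpz] using h₁
      · have hle := hs.normSq_aeval_neg_le hz
        rw [hq, h₂, h₁, hpz] at hle
        rw [h₁, hpz]
        generalize (-1) ^ p.natDegree * aeval (-z) p = w at *
        generalize p.leadingCoeff / p.nextCoeff = c at *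
        have e₁ : -w + c * z * ((0 - w) / 2) = (2 + c * z) * (-w / 2) := by ring
        have e₂ : 0 - c * z * ((0 - w) / 2) = (c * z) * (w / 2) := by ring
        rw [e₁, e₂, Complex.normSq_mul, Complex.normSq_mul, Complex.normSq_div, Complex.normSq_neg,
          Complex.normSq_div] at hle
        have e₃ : Complex.normSq (2 + c * z) = Complex.normSq (c * z) + 4 * (1 + c * z.re) := by
          simp [Complex.normSq_apply]; ring
        have hw : Complex.normSq w = 0 := by
          rw [e₃] at hle
          have hpos : 0 < 1 + c * z.re := by positivity
          have hN : Complex.normSq 2 = 4 := by simp; norm_num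
          rw [hN] at hle
          nlinarith [Complex.normSq_nonneg w]
        rw [Complex.normSq_eq_zero] at hw
        simp [hw]
    exact absurd (hs z hqz) (not_lt.2 hz)
  · intro hs z hqz
    by_contra! hz
    have h₁ := aeval_routhStep p z
    have h₂ := aeval_neg_routhStep hdeg z
    have hpz : aeval z p = 0 := by
      rcases hz.eq_or_lt with hz | hz
      · rw [haxis _ z hz.symm hqz, mul_zero] at h₂
        rw [hqz] at h₁
        have h₃ : aeval z p - (-1) ^ p.natDegree * aeval (-z) p = 0 := by
          linear_combination -h₁ - h₂
        rw [h₃] at h₁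
        simpa using h₁.symm
      · have hle := hs.normSq_aeval_sub_aeval_neg_le hlead hz
        rw [hqz] at h₁
        generalize (-1) ^ p.natDegree * aeval (-z) p = w at *
        generalize aeval z p = v at *
        have hca : p.leadingCoeff = p.leadingCoeff / p.nextCoeff * p.nextCoeff := by field_simp
        generalize p.leadingCoeff / p.nextCoeff = c at *
        obtain ⟨o, rfl⟩ : ∃ o, w = v - 2 * o := ⟨(v - w) / 2, by ring⟩
        obtain rfl : v = c * z * o := by linear_combination -h₁
        have e₁ : Complex.normSq (c * z * o) - Complex.normSq (c * z * o - 2 * o) =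
            4 * (c * z.re - 1) * Complex.normSq o := by
          simp [Complex.normSq_apply]; ring
        have e₂ : Complex.normSq (c * z * o - (c * z * o - 2 * o)) = 4 * Complex.normSq o := by
          simp [Complex.normSq_apply]; ring
        rw [e₁, e₂, hca] at hle
        have ho : Complex.normSq o = 0 := by
          nlinarith [Complex.normSq_nonneg o]
        rw [Complex.normSq_eq_zero] at ho
        simp [ho]
    exact absurd (hs z hpz) (not_lt.2 hz)

end Polynomial
namespace PowerSeries

/-- The Hankel matrix `(s_{i+k})` of size `j` of the coefficients of a power series. -/
noncomputable def hankel {R : Type*} [Semiring R] (S : PowerSeries R) (j : ℕ) :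
    Matrix (Fin j) (Fin j) R :=
  Matrix.of fun i k => coeff ((i : ℕ) + (k : ℕ)) S

/-- The lower triangular Toeplitz matrix of the coefficients of a power series. -/
noncomputable def toeplitz {R : Type*} [Semiring R] (V : PowerSeries R) (j : ℕ) :
    Matrix (Fin j) (Fin j) R :=
  Matrix.of fun i k => if k ≤ i then coeff ((i : ℕ) - (k : ℕ)) V else 0

variable {R : Type*} [CommRing R]

theorem det_toeplitz (V : PowerSeries R) (j : ℕ) :
    (toeplitz V j).det = constantCoeff V ^ j := by
  rw [Matrix.det_of_isLowerTriangular]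
  · simp [toeplitz]
  · intro i k hik
    simp only [toeplitz, Matrix.of_apply]
    exact if_neg (not_le.2 hik)

theorem det_toeplitz_transpose (V : PowerSeries R) (j : ℕ) :
    (toeplitz V j).transpose.det = constantCoeff V ^ j := by
  rw [Matrix.det_transpose, det_toeplitz]

theorem toeplitz_mul_hankel_apply (V S : PowerSeries R) (j : ℕ) (i k : Fin j) :
    (toeplitz V j * hankel S j) i k = coeff ((i : ℕ) + k) (V * S) -
      ∑ l ∈ Finset.range k, coeff ((i : ℕ) + k - l) V * coeff l S := by
  have h₁ : (toeplitz V j * hankel S j) i k =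
      ∑ m ∈ Finset.range (i + 1), coeff ((i : ℕ) - m) V * coeff (m + k) S := by
    rw [Matrix.mul_apply]
    simp only [toeplitz, hankel, Matrix.of_apply, Fin.le_def]
    rw [Fin.sum_univ_eq_sum_range (fun m => (if m ≤ (i : ℕ) then coeff ((i : ℕ) - m) V else 0) *
      coeff (m + k) S) j, ← Finset.sum_subset (Finset.range_subset_range.2 i.2)]
    · exact Finset.sum_congr rfl fun m hm => by
        rw [if_pos (Nat.lt_succ_iff.1 (Finset.mem_range.1 hm))]
    · intro m _ hm
      rw [if_neg (by simpa using hm), zero_mul]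
  rw [h₁, eq_sub_iff_add_eq, mul_comm V S, coeff_mul,
    Finset.Nat.sum_antidiagonal_eq_sum_range_succ (fun a b => coeff a S * coeff b V),
    show ((i : ℕ) + k).succ = k + (i + 1) by omega, Finset.sum_range_add _ (k : ℕ),
    add_comm]
  refine congrArg₂ _ ?_ ?_
  · exact Finset.sum_congr rfl fun l _ => mul_comm _ _
  · refine Finset.sum_congr rfl fun m _ => ?_
    rw [mul_comm, add_comm m, show (i : ℕ) + k - (k + m) = i - m by omega]

theorem hankel_mul_toeplitz_transpose_apply (H S : PowerSeries R) (j : ℕ) (i k : Fin j) :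
    (hankel H j * (toeplitz S j).transpose) i k =
      ∑ l ∈ Finset.range (k + 1), coeff ((i : ℕ) + k - l) H * coeff l S := by
  rw [Matrix.mul_apply]
  simp only [toeplitz, hankel, Matrix.of_apply, Fin.le_def, Matrix.transpose_apply]
  rw [Fin.sum_univ_eq_sum_range (fun m => coeff ((i : ℕ) + m) H *
    (if m ≤ (k : ℕ) then coeff ((k : ℕ) - m) S else 0)) j,
    ← Finset.sum_subset (Finset.range_subset_range.2 k.2), ← Finset.sum_range_reflect]
  · refine Finset.sum_congr rfl fun m hm => ?_
    have hm : m ≤ k := Nat.lt_succ_iff.1 (Finset.mem_range.1 hm)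
    rw [if_pos (by omega), show (i : ℕ) + (k + 1 - 1 - m) = i + k - m by omega,
      show (k : ℕ) - (k + 1 - 1 - m) = m by omega]
  · intro m _ hm
    rw [if_neg (by simpa using hm), mul_zero]

/-- Shifting `1 / T` by `X` does not change the Hankel determinants. -/
theorem det_hankel_eq_of_mul_one_add {T U : PowerSeries R} (h : U * (1 + X * T) = T) (j : ℕ) :
    (hankel U j).det = (hankel T j).det := by
  have key : toeplitz (1 + X * T) j * hankel U j =
      hankel T j * (toeplitz (1 - X * U) j).transpose := by
    ext i k
    rw [toeplitz_mul_hankel_apply, hankel_mul_toeplitz_transpose_apply, mul_comm, h,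
      Finset.sum_range_succ', sub_eq_add_neg, add_comm, ← Finset.sum_neg_distrib]
    congr 1
    · refine Finset.sum_congr rfl fun l hl => ?_
      have hl : l < k := Finset.mem_range.1 hl
      obtain ⟨d, hd⟩ : ∃ d, (i : ℕ) + k - l = d + 1 := ⟨i + k - l - 1, by omega⟩
      rw [hd, show (i : ℕ) + k - (l + 1) = d by omega]
      simp [coeff_succ_X_mul, coeff_one]
    · simp
  have := congrArg Matrix.det key
  rwa [Matrix.det_mul, Matrix.det_mul, det_toeplitz, det_toeplitz_transpose, map_add, map_sub,
    map_mul, map_mul, constantCoeff_X, map_one, zero_mul, zero_mul, add_zero, sub_zero, one_pow,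
    one_mul, mul_one] at this

/-- One step of the J-fraction expansion, on the level of Hankel determinants. -/
theorem det_hankel_succ_of_mul_eq {S H : PowerSeries R} {a s₀ : R}
    (h : (1 - C a * X - X ^ 2 * H) * S = C s₀) (j : ℕ) :
    (hankel S (j + 1)).det = s₀ ^ (j + 1) * (hankel H j).det := by
  set V : PowerSeries R := 1 - C a * X - X ^ 2 * H with hV
  have hV₀ : constantCoeff V = 1 := by simp [hV]
  have hV₂ : ∀ d, coeff (d + 2) V = -coeff d H := fun d => by
    rw [hV, map_sub, map_sub, coeff_X_pow_mul, coeff_C_mul, coeff_X, coeff_one]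
    simp
  have hS₀ : constantCoeff S = s₀ := by
    simpa [hV₀] using congrArg constantCoeff h
  have hrow : ∀ (i : Fin j) (k : Fin (j + 1)),
      (toeplitz V (j + 1) * hankel S (j + 1)) i.succ k =
        ∑ l ∈ Finset.range k, coeff ((i : ℕ) + k - l - 1) H * coeff l S := by
    intro i k
    rw [toeplitz_mul_hankel_apply, h, coeff_C, if_neg (by simp), zero_sub,
      ← Finset.sum_neg_distrib]
    refine Finset.sum_congr rfl fun l hl => ?_
    have hl : l < k := Finset.mem_range.1 hl
    rw [Fin.val_succ, show (i : ℕ) + 1 + k - l = (i + k - l - 1) + 2 by omega, hV₂]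
    ring
  have hdet : (toeplitz V (j + 1) * hankel S (j + 1)).det =
      s₀ * (hankel H j * (toeplitz S j).transpose).det := by
    rw [Matrix.det_succ_column_zero, Fin.sum_univ_succ, Finset.sum_eq_zero, add_zero]
    · rw [toeplitz_mul_hankel_apply, h]
      simp only [Fin.val_zero, pow_zero, one_mul, add_zero, Finset.range_zero, Finset.sum_empty,
        sub_zero, coeff_zero_C]
      congr 2
      ext i k
      rw [Matrix.submatrix_apply, Fin.succAbove_zero, hrow, hankel_mul_toeplitz_transpose_apply]
      refine Finset.sum_congr rfl fun l _ => ?_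
      rw [Fin.val_succ, show (i : ℕ) + (k + 1) - l - 1 = i + k - l by omega]
    · intro i _
      rw [hrow]
      simp
  rw [Matrix.det_mul, Matrix.det_mul, det_toeplitz, det_toeplitz_transpose, hV₀, hS₀, one_pow,
    one_mul] at hdet
  rw [hdet]
  ring

theorem det_hankel_C_mul (a : R) (S : PowerSeries R) (j : ℕ) :
    (hankel (C a * S) j).det = a ^ j * (hankel S j).det := by
  have : hankel (C a * S) j = a • hankel S j := by
    ext i k
    simp [hankel]
  rw [this, Matrix.det_smul, Fintype.card_fin]

end PowerSeries

namespace PowerSeries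

theorem det_hankel_succ_of_routh_relation {S U : PowerSeries ℝ} {c : ℝ} (hc : c ≠ 0)
    (h : 4 + 2 * C c * S + 2 * X * S + 2 * X * U + C c * X * S * U = 0) (j : ℕ) :
    (hankel S (j + 1)).det = (-2 / c) ^ (j + 1) * (1 / (2 * c)) ^ j * (hankel U j).det := by
  obtain ⟨T, hT⟩ : ∃ T, (2 + X * U) * T = -U := by
    have h₀ : constantCoeff (2 + X * U) ≠ 0 := by
      rw [map_add, map_ofNat, map_mul, constantCoeff_X, zero_mul, add_zero]
      exact two_ne_zero
    exact ⟨(2 + X * U)⁻¹ * -U, by rw [← mul_assoc, PowerSeries.mul_inv_cancel _ h₀, one_mul]⟩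
  have hCc : C (1 / c) * C c = 1 := by rw [← map_mul, one_div_mul_cancel hc, map_one]
  have hC₂ : (2 : PowerSeries ℝ) * C (1 / 2) = 1 := by
    rw [show (2 : PowerSeries ℝ) = C 2 from (map_ofNat C 2).symm, ← map_mul]
    norm_num
  have hU : (hankel (C (-(1 / 2)) * U) j).det = (hankel T j).det := by
    refine det_hankel_eq_of_mul_one_add ?_ j
    rw [map_neg]
    linear_combination (-C (1 / 2)) * hT + T * hC₂
  have hcancel : (2 : PowerSeries ℝ) * ((C c + X + X ^ 2 * T) * S + 2) = 0 := by
    linear_combination (1 + X * T) * h - (2 * X + C c * X * S) * hT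
  have hS : (C c + X + X ^ 2 * T) * S = -2 :=
    eq_neg_of_add_eq_zero_left
      ((mul_eq_zero.1 hcancel).resolve_left (left_ne_zero_of_mul_eq_one hC₂))
  have hmain : (1 - C (-(1 / c)) * X - X ^ 2 * (C (-(1 / c)) * T)) * S = C (-2 / c) := by
    have : C (-2 / c) = -2 * C (1 / c) := by
      rw [show (-2 : PowerSeries ℝ) = C (-2) by rw [map_neg, map_ofNat], ← map_mul]
      congr 1; ring
    rw [this, map_neg]
    linear_combination C (1 / c) * hS - S * hCc
  rw [det_hankel_succ_of_mul_eq hmain, det_hankel_C_mul, ← hU, det_hankel_C_mul, ← mul_assoc,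
    ← mul_assoc, mul_assoc _ _ ((-(1 / 2)) ^ j), ← mul_pow]
  congr 3
  field_simp

end PowerSeries

namespace Polynomial

/-- The power series `w ^ n * p (1 / w)`. -/
noncomputable def reverseSeries (n : ℕ) (p : ℝ[X]) : PowerSeries ℝ :=
  PowerSeries.mk fun k => if k ≤ n then p.coeff (n - k) else 0

theorem coeff_evalNegHom (f : PowerSeries ℝ) (k : ℕ) :
    PowerSeries.coeff k (PowerSeries.evalNegHom f) = (-1) ^ k * PowerSeries.coeff k f :=
  PowerSeries.coeff_rescale f (-1) k

theorem evalNegHom_evalNegHom (f : PowerSeries ℝ) :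
    PowerSeries.evalNegHom (PowerSeries.evalNegHom f) = f := by
  ext k
  rw [coeff_evalNegHom, coeff_evalNegHom, ← mul_assoc, ← mul_pow]
  simp

theorem constantCoeff_reverseSeries (n : ℕ) (p : ℝ[X]) :
    PowerSeries.constantCoeff (reverseSeries n p) = p.coeff n := by
  simp [reverseSeries, ← PowerSeries.coeff_zero_eq_constantCoeff_apply]

theorem exists_evalNegHom_eq_mul {Q : PowerSeries ℝ} (hQ : PowerSeries.constantCoeff Q ≠ 0) :
    ∃ U, PowerSeries.evalNegHom Q = Q * (1 + PowerSeries.X * U) := by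
  set W := Q⁻¹ * PowerSeries.evalNegHom Q with hW
  have hQW : PowerSeries.evalNegHom Q = Q * W := by
    rw [hW, ← mul_assoc, PowerSeries.mul_inv_cancel _ hQ, one_mul]
  have hW₀ : PowerSeries.constantCoeff W = 1 := by
    rw [hW, map_mul, PowerSeries.constantCoeff_inv,
      ← PowerSeries.coeff_zero_eq_constantCoeff_apply (PowerSeries.evalNegHom Q), coeff_evalNegHom]
    simp [hQ]
  have hshift := PowerSeries.sub_const_eq_X_mul_shift W
  rw [hW₀, map_one] at hshift
  exact ⟨_, by rw [hQW, ← hshift, add_sub_cancel]⟩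

theorem reverseSeries_routhStep {p : ℝ[X]} {n : ℕ} (hdeg : p.natDegree = n + 1)
    (hnext : p.nextCoeff ≠ 0) :
    2 * PowerSeries.X ^ 2 * reverseSeries n p.routhStep =
      2 * PowerSeries.X * reverseSeries (n + 1) p -
        PowerSeries.C (p.leadingCoeff / p.nextCoeff) *
          (reverseSeries (n + 1) p - PowerSeries.evalNegHom (reverseSeries (n + 1) p)) := by
  have h₂ : (2 : PowerSeries ℝ) = PowerSeries.C 2 := (map_ofNat PowerSeries.C 2).symm
  ext k
  rw [h₂, mul_assoc, mul_assoc, map_sub, PowerSeries.coeff_C_mul, PowerSeries.coeff_C_mul,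
    PowerSeries.coeff_C_mul, map_sub, coeff_evalNegHom]
  match k with
  | 0 => simp
  | 1 =>
    rw [PowerSeries.coeff_X_pow_mul', PowerSeries.coeff_succ_X_mul]
    simp only [reverseSeries, PowerSeries.coeff_mk]
    rw [nextCoeff_of_natDegree_succ hdeg] at *
    simp [leadingCoeff, hdeg]
    field_simp
    ring
  | k + 2 =>
    rw [PowerSeries.coeff_X_pow_mul, PowerSeries.coeff_succ_X_mul]
    simp only [reverseSeries, PowerSeries.coeff_mk]
    rcases lt_trichotomy k n with hk | rfl | hk
    · obtain ⟨d, rfl⟩ : ∃ d, n = k + d + 1 := ⟨n - k - 1, by omega⟩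
      rw [if_pos (by omega), if_pos (by omega), if_pos (by omega),
        show k + d + 1 - k = d + 1 by omega, show k + d + 1 + 1 - (k + 1) = d + 1 by omega,
        show k + d + 1 + 1 - (k + 2) = d by omega, coeff_routhStep_succ, hdeg,
        show k + d + 1 + 1 + d = 2 * d + (k + 2) by ring, pow_add, pow_mul]
      simp
      ring
    · simp [coeff_routhStep_zero]
    · rw [if_neg (by omega), if_neg (by omega), if_neg (by omega)]
      simp

theorem routh_relation {p : ℝ[X]} {n : ℕ} (hdeg : p.natDegree = n + 1)
    (hlead : p.leadingCoeff ≠ 0) (hnext : p.nextCoeff ≠ 0) {S U : PowerSeries ℝ}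
    (hS : PowerSeries.evalNegHom (reverseSeries (n + 1) p) =
      reverseSeries (n + 1) p * (1 + PowerSeries.X * S))
    (hU : PowerSeries.evalNegHom (reverseSeries n p.routhStep) =
      reverseSeries n p.routhStep * (1 + PowerSeries.X * U)) :
    4 + 2 * PowerSeries.C (p.leadingCoeff / p.nextCoeff) * S + 2 * PowerSeries.X * S +
      2 * PowerSeries.X * U +
      PowerSeries.C (p.leadingCoeff / p.nextCoeff) * PowerSeries.X * S * U = 0 := by
  have h := reverseSeries_routhStep hdeg hnext
  have h' := congrArg PowerSeries.evalNegHom h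
  have hP₀ : reverseSeries (n + 1) p ≠ 0 := by
    intro h₀
    have := constantCoeff_reverseSeries (n + 1) p
    rw [h₀, map_zero, ← hdeg] at this
    exact hlead this.symm
  have hC : ∀ a : ℝ, PowerSeries.evalNegHom (PowerSeries.C a) = PowerSeries.C a := fun a => by
    ext k
    rw [coeff_evalNegHom, PowerSeries.coeff_C]
    split_ifs with hk <;> simp [hk]
  simp only [map_mul, map_sub, map_pow, map_ofNat, PowerSeries.evalNegHom_X, hC,
    evalNegHom_evalNegHom] at h'
  rw [hS, hU] at h'
  rw [hS] at h
  refine (mul_eq_zero.1 ?_).resolve_left (mul_ne_zero PowerSeries.X_ne_zero hP₀)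
  linear_combination h' - (1 + PowerSeries.X * U) * h

/-- The stability criterion with the Laurent coefficients collected in a power series. -/
theorem hurwitzStable_iff_det_hankel (n : ℕ) (p : ℝ[X]) (hdeg : p.natDegree = n)
    (hlead : 0 < p.leadingCoeff) (S : PowerSeries ℝ)
    (hS : PowerSeries.evalNegHom (reverseSeries n p) =
      reverseSeries n p * (1 + PowerSeries.X * S)) :
    HurwitzStable p ↔ ∀ j, 1 ≤ j → j ≤ n →
      0 < (-1 : ℝ) ^ (j * (j + 1) / 2) * (PowerSeries.hankel S j).det := by
  induction n generalizing p S with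
  | zero =>
    refine iff_of_true (fun z hz => ?_) fun j h₁ h₂ => by omega
    rw [eq_C_of_natDegree_eq_zero hdeg, aeval_C] at hz
    rw [leadingCoeff, hdeg] at hlead
    exact absurd (by simpa using hz) hlead.ne'
  | succ n ih =>
    have hs₀ : PowerSeries.constantCoeff S * p.leadingCoeff = -2 * p.nextCoeff := by
      have := congrArg (PowerSeries.coeff 1) hS
      rw [coeff_evalNegHom, mul_add, mul_one, mul_left_comm, map_add,
        PowerSeries.coeff_succ_X_mul, PowerSeries.coeff_zero_eq_constantCoeff_apply, map_mul,
        constantCoeff_reverseSeries, reverseSeries, PowerSeries.coeff_mk,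
        if_pos (Nat.le_add_left 1 n), Nat.add_sub_cancel] at this
      rw [nextCoeff_of_natDegree_succ hdeg, leadingCoeff, hdeg]
      linarith
    have hD₁ : (PowerSeries.hankel S 1).det = PowerSeries.constantCoeff S := by
      simp [PowerSeries.hankel]
    by_cases hnext : 0 < p.nextCoeff
    · have hq₁ := natDegree_routhStep hdeg hnext.ne'
      have hq₂ : 0 < p.routhStep.leadingCoeff := by
        rwa [leadingCoeff_routhStep hdeg hnext.ne']
      obtain ⟨U, hU⟩ := exists_evalNegHom_eq_mul (Q := reverseSeries n p.routhStep) (by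
        rw [constantCoeff_reverseSeries, ← hq₁]
        exact hq₂.ne')
      have hc : 0 < p.leadingCoeff / p.nextCoeff := div_pos hlead hnext
      have hdet := PowerSeries.det_hankel_succ_of_routh_relation hc.ne'
        (routh_relation hdeg hlead.ne' hnext.ne' hS hU)
      have hstep : ∀ j, 0 < (-1 : ℝ) ^ ((j + 1) * (j + 1 + 1) / 2) *
            (PowerSeries.hankel S (j + 1)).det ↔
          0 < (-1 : ℝ) ^ (j * (j + 1) / 2) * (PowerSeries.hankel U j).det := by
        intro j
        generalize p.leadingCoeff / p.nextCoeff = c at *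
        have he : (j + 1) * (j + 1 + 1) / 2 = j * (j + 1) / 2 + (j + 1) := by
          rw [show (j + 1) * (j + 1 + 1) = j * (j + 1) + (j + 1) * 2 by ring,
            Nat.add_mul_div_right _ _ two_pos]
        have hpos : 0 < (2 / c) ^ (j + 1) * (1 / (2 * c)) ^ j := by positivity
        rw [← mul_pos_iff_of_pos_left hpos (b := (-1 : ℝ) ^ (j * (j + 1) / 2) * _), he, hdet,
          pow_add, show -2 / c = -1 * (2 / c) by ring, mul_pow (-1) (2 / c)]
        have h1 : (-1 : ℝ) ^ (j + 1) * (-1) ^ (j + 1) = 1 := by rw [← mul_pow]; simp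
        refine iff_of_eq (congrArg _ ?_)
        linear_combination ((-1 : ℝ) ^ (j * (j + 1) / 2) * ((2 / c) ^ (j + 1) *
          (1 / (2 * c)) ^ j) * (PowerSeries.hankel U j).det) * h1
      rw [← hurwitzStable_routhStep_iff hdeg hlead hnext, ih _ hq₁ hq₂ U hU]
      constructor
      · rintro h (_ | j) h₁ h₂
        · omega
        · rw [hstep]
          rcases j.eq_zero_or_pos with rfl | hj
          · simp
          · exact h j hj (by omega)
      · intro h j h₁ h₂
        exact (hstep j).1 (h (j + 1) (by omega) (by omega))
    · refine iff_of_false (fun h => hnext (h.nextCoeff_pos hlead (by omega))) fun h => hnext ?_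
      have h₁ := h 1 le_rfl (by omega)
      rw [hD₁] at h₁
      norm_num at h₁
      nlinarith

end Polynomial

/-- Stability criterion via Hankel determinants of `R(z) = (-1)^n p(-z)/p(z)`.  Writing
`p(z) = Σ_{k=0}^n a_k z^{n-k}` and letting `s_0, s_1, …` be the Laurent coefficients at
infinity of `R`, i.e. (with `w = 1/z`) the formal power series identity
`Σ (-1)^k a_k w^k = (Σ a_k w^k) · (1 + Σ_j s_j w^{j+1})` holds, the polynomial `p` is
Hurwitz stable iff `(-1)^{j(j+1)/2} D_j(R) > 0` for `j = 1, …, n`, where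
`D_j(R) = det[(s_{i+k})_{i,k=0}^{j-1}]`. -/
theorem hurwitzStable_iff_hankel_det_of_R
    (n : ℕ) (hn : 1 ≤ n) (p : Polynomial ℝ)
    (hdeg : p.natDegree = n) (hlead : 0 < p.leadingCoeff)
    (s : ℕ → ℝ)
    (hs : PowerSeries.mk (fun k => (-1 : ℝ) ^ k * (if k ≤ n then p.coeff (n - k) else 0)) =
        PowerSeries.mk (fun k => if k ≤ n then p.coeff (n - k) else 0) *
          PowerSeries.mk (fun j => if j = 0 then 1 else s (j - 1))) :
    HurwitzStable p ↔
      ∀ j, 1 ≤ j → j ≤ n →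
        0 < (-1 : ℝ) ^ (j * (j + 1) / 2) *
          Matrix.det (Matrix.of fun i k : Fin j => s ((i : ℕ) + (k : ℕ))) := by
  have hP : PowerSeries.evalNegHom (reverseSeries n p) =
      reverseSeries n p * (1 + PowerSeries.X * PowerSeries.mk s) := by
    have h₁ : PowerSeries.mk (fun j => if j = 0 then 1 else s (j - 1)) =
        1 + PowerSeries.X * PowerSeries.mk s := by
      ext k
      cases k <;> simp [PowerSeries.coeff_succ_X_mul, PowerSeries.coeff_one]
    rw [← h₁, reverseSeries, ← hs]
    ext k
    rw [coeff_evalNegHom, PowerSeries.coeff_mk, PowerSeries.coeff_mk]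
  simpa [PowerSeries.hankel] using hurwitzStable_iff_det_hankel n p hdeg hlead _ hP
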